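/- arXiv:2601.13390 — 2 statements merged into one kernel-verified Lean document; each statement's English description precedes it below -/
import Mathlib

section
/- For every k ≥ 3 there exist simple graphs G and H, each on k+3 vertices, such that X_G = X_H, G is k-connected but not (k+1)-connected, and H is (k−1)-connected but not k-connected. -/
/-- The number of proper colorings of `G` whose color class size vector is `d`. -/
noncomputable def numColorings {V : Type} (G : SimpleGraph V) (d : ℕ →₀ ℕ) : ℕ :=
  Nat.card {c : V → ℕ // (∀ ⦃u v : V⦄, G.Adj u v → c u ≠ c v) ∧
    ∀ i : ℕ, Nat.card {x : V // c x = i} = d i}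

/-- The chromatic symmetric function of `G`, as a multivariate power series: its coefficient
on the monomial `x^d` is the number of proper colorings with color class size vector `d`. -/
noncomputable def csf {V : Type} (G : SimpleGraph V) : MvPowerSeries ℕ ℚ :=
  fun d => (numColorings G d : ℚ)

/-- A simple graph is `k`-connected if it has at least `k+1` vertices and deleting any
set of `k-1` vertices leaves a connected induced subgraph. -/
def KConnected {V : Type} (k : ℕ) (G : SimpleGraph V) : Prop :=
  k + 1 ≤ Nat.card V ∧ ∀ S : Set V, S.ncard = k - 1 → (G.induce Sᶜ).Connected

/-- The edges of the path `0 - 1 - 2 - 3 - 4`, as a symmetric relation on `ℕ`. -/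
def PathRel (a b : ℕ) : Prop :=
  (a + 1 = b ∧ b ≤ 4) ∨ (b + 1 = a ∧ a ≤ 4)

/-- The edges of the five-cycle on `0, 1, 2, 3, 4`. -/
def CycleRel (a b : ℕ) : Prop :=
  PathRel a b ∨ (a = 0 ∧ b = 4) ∨ (a = 4 ∧ b = 0)

/-- The edges of the fork: the path `0 - 1 - 2 - 3 - 4` with a further leaf `5` attached at `1`. -/
def ForkRel (a b : ℕ) : Prop :=
  PathRel a b ∨ (a = 1 ∧ b = 5) ∨ (a = 5 ∧ b = 1)

/-- The complement of the five-cycle together with isolated vertices. -/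
def cycleCompl (n : ℕ) : SimpleGraph (Fin n) where
  Adj u v := u.val ≠ v.val ∧ ¬ CycleRel u v
  symm := ⟨fun u v h => by unfold CycleRel PathRel at *; omega⟩
  loopless := ⟨fun u h => h.1 rfl⟩

/-- The complement of the fork together with isolated vertices. -/
def forkCompl (n : ℕ) : SimpleGraph (Fin n) where
  Adj u v := u.val ≠ v.val ∧ ¬ ForkRel u v
  symm := ⟨fun u v h => by unfold ForkRel PathRel at *; omega⟩
  loopless := ⟨fun u h => h.1 rfl⟩

/-- The involution `(0 5)(1 4)(2 3)` of `ℕ`. -/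
def flipVal (a : ℕ) : ℕ := if a ≤ 5 then 5 - a else a

lemma flipVal_flipVal (a : ℕ) : flipVal (flipVal a) = a := by
  unfold flipVal; split_ifs <;> omega

/-- The involution `(0 5)(1 4)(2 3)` of `Fin (k + 3)`. -/
def flipPerm (k : ℕ) (hk : 3 ≤ k) : Equiv.Perm (Fin (k + 3)) :=
  Function.Involutive.toPerm
    (fun u => ⟨flipVal u, by have := u.isLt; unfold flipVal; split_ifs <;> omega⟩)
    (fun u => Fin.ext (flipVal_flipVal u))

lemma flipPerm_val (k : ℕ) (hk : 3 ≤ k) (u : Fin (k + 3)) :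
    (flipPerm k hk u).val = flipVal u := rfl

lemma flipPerm_flipPerm (k : ℕ) (hk : 3 ≤ k) (u : Fin (k + 3)) :
    flipPerm k hk (flipPerm k hk u) = u := Fin.ext (flipVal_flipVal u)

/-- Precomposing with a permutation preserves the sizes of the color classes. -/
lemma card_fiber_comp_perm {V : Type} (σ : Equiv.Perm V) (c : V → ℕ) (i : ℕ) :
    Nat.card {x : V // c (σ x) = i} = Nat.card {x : V // c x = i} :=
  Nat.card_congr (σ.subtypeEquiv fun _ => Iff.rfl)

/-- A permutation flipping some colorings of one graph into colorings of another, and conversely,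
while fixing the remaining ones, shows that the graphs have the same chromatic symmetric
function. -/
lemma csf_eq_of_involution {V : Type} (G H : SimpleGraph V) (σ : Equiv.Perm V)
    (hσ : ∀ u, σ (σ u) = u) (a b : V)
    (h₁ : ∀ c : V → ℕ, (∀ ⦃u v⦄, G.Adj u v → c u ≠ c v) → c a = c b →
      ∀ ⦃u v⦄, H.Adj u v → c (σ u) ≠ c (σ v))
    (h₂ : ∀ c : V → ℕ, (∀ ⦃u v⦄, G.Adj u v → c u ≠ c v) → c a ≠ c b →
      (∀ ⦃u v⦄, H.Adj u v → c u ≠ c v) ∧ c (σ a) ≠ c (σ b))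
    (h₃ : ∀ c : V → ℕ, (∀ ⦃u v⦄, H.Adj u v → c u ≠ c v) → c (σ a) = c (σ b) →
      ∀ ⦃u v⦄, G.Adj u v → c (σ u) ≠ c (σ v))
    (h₄ : ∀ c : V → ℕ, (∀ ⦃u v⦄, H.Adj u v → c u ≠ c v) → c (σ a) ≠ c (σ b) →
      (∀ ⦃u v⦄, G.Adj u v → c u ≠ c v) ∧ c a ≠ c b) :
    csf G = csf H := by
  classical
  funext d
  unfold csf numColorings
  congr 1
  refine Nat.card_congr
    { toFun := fun c => if h : c.1 a = c.1 b then ⟨c.1 ∘ σ, h₁ c.1 c.2.1 h, fun i =>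
          (card_fiber_comp_perm σ c.1 i).trans (c.2.2 i)⟩
        else ⟨c.1, (h₂ c.1 c.2.1 h).1, c.2.2⟩
      invFun := fun c => if h : c.1 (σ a) = c.1 (σ b) then ⟨c.1 ∘ σ, h₃ c.1 c.2.1 h, fun i =>
          (card_fiber_comp_perm σ c.1 i).trans (c.2.2 i)⟩
        else ⟨c.1, (h₄ c.1 c.2.1 h).1, c.2.2⟩
      left_inv := ?_
      right_inv := ?_ }
  · intro c
    by_cases h : c.1 a = c.1 b
    · apply Subtype.ext
      funext u
      simp [h, hσ]
    · simp [h, (h₂ c.1 c.2.1 h).2]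
  · intro c
    by_cases h : c.1 (σ a) = c.1 (σ b)
    · apply Subtype.ext
      funext u
      simp [h, hσ]
    · simp [h, (h₄ c.1 c.2.1 h).2]

lemma cycleCompl_rel {n : ℕ} {c : Fin n → ℕ}
    (hc : ∀ ⦃u v⦄, (cycleCompl n).Adj u v → c u ≠ c v) {u v : Fin n} (h : c u = c v) :
    u.val = v.val ∨ CycleRel u v := by
  by_contra! h'
  exact hc (show (cycleCompl n).Adj u v from h') h

lemma forkCompl_rel {n : ℕ} {c : Fin n → ℕ}
    (hc : ∀ ⦃u v⦄, (forkCompl n).Adj u v → c u ≠ c v) {u v : Fin n} (h : c u = c v) :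
    u.val = v.val ∨ ForkRel u v := by
  by_contra! h'
  exact hc (show (forkCompl n).Adj u v from h') h

lemma csf_cycleCompl_eq_csf_forkCompl (k : ℕ) (hk : 3 ≤ k) :
    csf (cycleCompl (k + 3)) = csf (forkCompl (k + 3)) := by
  have hσ0 : flipPerm k hk ⟨0, by omega⟩ = ⟨5, by omega⟩ := rfl
  have hσ4 : flipPerm k hk ⟨4, by omega⟩ = ⟨1, by omega⟩ := rfl
  refine csf_eq_of_involution _ _ (flipPerm k hk) (flipPerm_flipPerm k hk)
    ⟨0, by omega⟩ ⟨4, by omega⟩ ?_ ?_ ?_ ?_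
  · intro c hc h u v huv huv'
    have excl {x y : Fin (k + 3)} (e : c x = c y) :
        ¬ (x.val = 0 ∧ y.val = 1) ∧ ¬ (x.val = 4 ∧ y.val = 3) := by
      refine ⟨fun ⟨hx, hy⟩ => ?_, fun ⟨hx, hy⟩ => ?_⟩
      · rw [show x = ⟨0, by omega⟩ from Fin.ext hx, h] at e
        have := cycleCompl_rel hc e
        simp [CycleRel, PathRel, hy] at this
      · rw [show x = ⟨4, by omega⟩ from Fin.ext hx, ← h] at e
        have := cycleCompl_rel hc e
        simp [CycleRel, PathRel, hy] at this
    have key := cycleCompl_rel hc huv'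
    have e₁ := excl huv'
    have e₂ := excl huv'.symm
    simp only [flipPerm_val, flipVal, forkCompl, CycleRel, ForkRel, PathRel] at *
    grind
  · intro c hc h
    rw [hσ0, hσ4]
    refine ⟨fun u v huv huv' => ?_, fun e => ?_⟩
    · have key := cycleCompl_rel hc huv'
      have excl {x y : Fin (k + 3)} (e : c x = c y) : ¬ (x.val = 0 ∧ y.val = 4) := by
        rintro ⟨hx, hy⟩
        rw [show x = ⟨0, by omega⟩ from Fin.ext hx, show y = ⟨4, by omega⟩ from Fin.ext hy] at e
        exact h e
      have e₁ := excl huv'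
      have e₂ := excl huv'.symm
      simp only [forkCompl, CycleRel, ForkRel, PathRel] at *
      grind
    · have := cycleCompl_rel hc e
      simp [CycleRel, PathRel] at this
  · rw [hσ0, hσ4]
    intro c hc h u v huv huv'
    have excl {x y : Fin (k + 3)} (e : c x = c y) :
        ¬ (x.val = 1 ∧ y.val = 0) ∧ ¬ (x.val = 1 ∧ y.val = 2) := by
      refine ⟨fun ⟨hx, hy⟩ => ?_, fun ⟨hx, hy⟩ => ?_⟩ <;>
      · rw [show x = ⟨1, by omega⟩ from Fin.ext hx, ← h] at e
        have := forkCompl_rel hc e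
        simp [ForkRel, PathRel, hy] at this
    have key := forkCompl_rel hc huv'
    have e₁ := excl huv'
    have e₂ := excl huv'.symm
    simp only [flipPerm_val, flipVal, cycleCompl, CycleRel, ForkRel, PathRel] at *
    grind
  · rw [hσ0, hσ4]
    intro c hc h
    refine ⟨fun u v huv huv' => ?_, fun e => ?_⟩
    · have key := forkCompl_rel hc huv'
      have excl {x y : Fin (k + 3)} (e : c x = c y) : ¬ (x.val = 5 ∧ y.val = 1) := by
        rintro ⟨hx, hy⟩
        rw [show x = ⟨5, by omega⟩ from Fin.ext hx, show y = ⟨1, by omega⟩ from Fin.ext hy] at e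
        exact h e
      have e₁ := excl huv'
      have e₂ := excl huv'.symm
      simp only [cycleCompl, CycleRel, ForkRel, PathRel] at *
      grind
    · have := forkCompl_rel hc e
      simp [ForkRel, PathRel] at this

/-- A nonempty induced subgraph in which any two distinct vertices are joined by a path of length
at most three is connected. -/
lemma induce_connected_of_short_paths {V : Type} (G : SimpleGraph V) (T : Set V)
    (hT : T.Nonempty)
    (h : ∀ u ∈ T, ∀ v ∈ T, u ≠ v → G.Adj u v ∨
      (∃ w ∈ T, G.Adj u w ∧ G.Adj w v) ∨
      ∃ w ∈ T, ∃ x ∈ T, G.Adj u w ∧ G.Adj w x ∧ G.Adj x v) :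
    (G.induce T).Connected := by
  have adj {u v : V} (hu : u ∈ T) (hv : v ∈ T) (e : G.Adj u v) :
      (G.induce T).Reachable ⟨u, hu⟩ ⟨v, hv⟩ :=
    SimpleGraph.Adj.reachable (G := G.induce T) e
  have : Nonempty T := hT.to_subtype
  refine SimpleGraph.Connected.mk ?_
  rintro ⟨u, hu⟩ ⟨v, hv⟩
  by_cases huv : u = v
  · subst huv; exact .rfl
  rcases h u hu v hv huv with e | ⟨w, hw, e, f⟩ | ⟨w, hw, x, hx, e, f, g⟩
  · exact adj hu hv e
  · exact (adj hu hw e).trans (adj hw hv f)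
  · exact ((adj hu hw e).trans (adj hw hx f)).trans (adj hx hv g)

/-- An induced subgraph with at least two vertices, one of which is isolated, is disconnected. -/
lemma not_induce_connected_of_isolated {V : Type} (G : SimpleGraph V) (T : Set V) {u v : V}
    (hu : u ∈ T) (hv : v ∈ T) (huv : u ≠ v) (h : ∀ w ∈ T, ¬ G.Adj u w) :
    ¬ (G.induce T).Connected := by
  intro hc
  have : Nontrivial T := ⟨⟨u, hu⟩, ⟨v, hv⟩, fun e => huv (congrArg Subtype.val e)⟩
  obtain ⟨w, hw⟩ := hc.preconnected.exists_adj_of_nontrivial ⟨u, hu⟩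
  exact h w.1 w.2 hw

lemma ncard_compl_fin {n : ℕ} (S : Set (Fin n)) : S.ncard + Sᶜ.ncard = n := by
  simpa using Set.ncard_add_ncard_compl S

lemma Set.exists_mem_notMem_finset_of_card_lt {α : Type*} {T : Set α} {F : Finset α}
    (h : F.card < T.ncard) : ∃ x ∈ T, x ∉ F := by
  obtain ⟨x, hx, hx'⟩ := Set.exists_mem_notMem_of_ncard_lt_ncard (s := (F : Set α)) (t := T)
    (by simpa using h)
  exact ⟨x, hx, by simpa using hx'⟩

lemma kConnected_cycleCompl (k : ℕ) (hk : 3 ≤ k) : KConnected k (cycleCompl (k + 3)) := by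
  refine ⟨by simp, fun S hS => ?_⟩
  have hT : Sᶜ.ncard = 4 := by have := ncard_compl_fin S; omega
  refine induce_connected_of_short_paths _ _ (Set.nonempty_of_ncard_ne_zero (by omega)) ?_
  intro u hu v hv huv
  obtain ⟨w, hw, hwF⟩ := Set.exists_mem_notMem_finset_of_card_lt (T := Sᶜ) (F := {u, v})
    (Finset.card_le_two.trans_lt (by omega))
  obtain ⟨x, hx, hxF⟩ := Set.exists_mem_notMem_finset_of_card_lt (T := Sᶜ) (F := {u, v, w})
    (Finset.card_le_three.trans_lt (by omega))
  simp only [Finset.mem_insert, Finset.mem_singleton, not_or, Fin.ext_iff] at hwF hxF huv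
  by_cases h : (cycleCompl (k + 3)).Adj u v
  · exact Or.inl h
  right
  by_contra! hcon
  have c₁ := hcon.1 w hw
  have c₂ := hcon.1 x hx
  have c₃ := hcon.2 w hw x hx
  have c₄ := hcon.2 x hx w hw
  clear hcon
  simp only [cycleCompl, CycleRel, PathRel] at h c₁ c₂ c₃ c₄
  grind

/-- The only edge of the fork whose ends have three further neighbors is the one between `1`
and `2`. -/
lemma forkRel_three_neighbors {a b w x y : ℕ} (h : ForkRel a b)
    (hw : ForkRel a w ∨ ForkRel w b) (hx : ForkRel a x ∨ ForkRel x b)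
    (hy : ForkRel a y ∨ ForkRel y b) (hw' : ¬ w = a ∧ ¬ w = b)
    (hx' : ¬ x = a ∧ ¬ x = b ∧ ¬ x = w) (hy' : ¬ y = a ∧ ¬ y = b ∧ ¬ y = w ∧ ¬ y = x) :
    (a = 1 ∧ b = 2) ∨ (a = 2 ∧ b = 1) := by
  simp only [ForkRel, PathRel] at *
  have ha : a < 6 := by omega
  have hb : b < 6 := by omega
  interval_cases a <;> interval_cases b <;> simp at h ⊢ <;> grind

lemma forkRel_neighbors_mem {a b w : ℕ} (h : (a = 1 ∧ b = 2) ∨ (a = 2 ∧ b = 1))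
    (hw : ForkRel a w ∨ ForkRel w b) (hw' : ¬ w = a ∧ ¬ w = b) :
    w = 0 ∨ w = 3 ∨ w = 5 := by
  simp only [ForkRel, PathRel] at *
  omega

lemma kConnected_forkCompl (k : ℕ) (hk : 3 ≤ k) :
    KConnected (k - 1) (forkCompl (k + 3)) := by
  refine ⟨by simp; omega, fun S hS => ?_⟩
  have hT : Sᶜ.ncard = 5 := by have := ncard_compl_fin S; omega
  refine induce_connected_of_short_paths _ _ (Set.nonempty_of_ncard_ne_zero (by omega)) ?_
  intro u hu v hv huv
  obtain ⟨w, hw, hwF⟩ := Set.exists_mem_notMem_finset_of_card_lt (T := Sᶜ) (F := {u, v})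
    (Finset.card_le_two.trans_lt (by omega))
  obtain ⟨x, hx, hxF⟩ := Set.exists_mem_notMem_finset_of_card_lt (T := Sᶜ) (F := {u, v, w})
    (Finset.card_le_three.trans_lt (by omega))
  obtain ⟨y, hy, hyF⟩ := Set.exists_mem_notMem_finset_of_card_lt (T := Sᶜ) (F := {u, v, w, x})
    (Finset.card_le_four.trans_lt (by omega))
  simp only [Finset.mem_insert, Finset.mem_singleton, not_or, Fin.ext_iff] at hwF hxF hyF
  have huv_val := Fin.val_ne_of_ne huv
  by_cases h : (forkCompl (k + 3)).Adj u v
  · exact Or.inl h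
  right
  by_contra! hcon
  have edge : ForkRel u v := by
    by_contra e
    exact h ⟨huv_val, e⟩
  have nbr (z : Fin (k + 3)) (hz : z ∈ Sᶜ) (hu : ¬ z.val = u) (hv : ¬ z.val = v) :
      ForkRel u z ∨ ForkRel z v := by
    by_contra! e
    exact hcon.1 z hz ⟨Ne.symm hu, e.1⟩ ⟨hv, e.2⟩
  have no_path (z : Fin (k + 3)) (hz : z ∈ Sᶜ) (t : Fin (k + 3)) (ht : t ∈ Sᶜ)
      (hzt : ¬ z.val = t) (hu : ¬ z.val = u) (hv : ¬ t.val = v) :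
      ForkRel u z ∨ ForkRel z t ∨ ForkRel t v := by
    by_contra! e
    exact hcon.2 z hz t ht ⟨Ne.symm hu, e.1⟩ ⟨hzt, e.2.1⟩ ⟨hv, e.2.2⟩
  have nw := nbr w hw hwF.1 hwF.2
  have nx := nbr x hx hxF.1 hxF.2.1
  have ny := nbr y hy hyF.1 hyF.2.1
  have d₁ := no_path w hw x hx (Ne.symm hxF.2.2) hwF.1 hxF.2.1
  have d₂ := no_path w hw y hy (Ne.symm hyF.2.2.1) hwF.1 hyF.2.1
  have d₃ := no_path x hx w hw hxF.2.2 hxF.1 hwF.2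
  have d₄ := no_path x hx y hy (Ne.symm hyF.2.2.2) hxF.1 hyF.2.1
  have d₅ := no_path y hy w hw hyF.2.2.1 hyF.1 hwF.2
  have d₆ := no_path y hy x hx hyF.2.2.2 hyF.1 hxF.2.1
  clear hcon h nbr no_path
  have mid := forkRel_three_neighbors edge nw nx ny hwF hxF hyF
  have mw := forkRel_neighbors_mem mid nw hwF
  have mx := forkRel_neighbors_mem mid nx ⟨hxF.1, hxF.2.1⟩
  have my := forkRel_neighbors_mem mid ny ⟨hyF.1, hyF.2.1⟩
  clear nw nx ny edge
  rcases mw with mw | mw | mw <;> rcases mx with mx | mx | mx <;>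
    rcases my with my | my | my <;> rcases mid with ⟨e, f⟩ | ⟨e, f⟩ <;>
    simp_all [ForkRel, PathRel]

lemma not_kConnected_cycleCompl (k : ℕ) (hk : 3 ≤ k) :
    ¬ KConnected (k + 1) (cycleCompl (k + 3)) := by
  rintro ⟨-, h⟩
  let T : Finset (Fin (k + 3)) := {⟨1, by omega⟩, ⟨0, by omega⟩, ⟨2, by omega⟩}
  have hT : T.card = 3 := by simp [T]
  refine not_induce_connected_of_isolated (cycleCompl (k + 3)) ((T : Set _)ᶜᶜ)
    (u := ⟨1, by omega⟩) (v := ⟨0, by omega⟩) (by simp [T]) (by simp [T]) (by simp) ?_ (h _ ?_)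
  · simp [T, cycleCompl, CycleRel, PathRel]
  · have := ncard_compl_fin (T : Set (Fin (k + 3)))
    rw [Set.ncard_coe_finset, hT] at this
    omega

lemma not_kConnected_forkCompl (k : ℕ) (hk : 3 ≤ k) :
    ¬ KConnected k (forkCompl (k + 3)) := by
  rintro ⟨-, h⟩
  let T : Finset (Fin (k + 3)) := {⟨1, by omega⟩, ⟨0, by omega⟩, ⟨2, by omega⟩, ⟨5, by omega⟩}
  have hT : T.card = 4 := by simp [T]
  refine not_induce_connected_of_isolated (forkCompl (k + 3)) ((T : Set _)ᶜᶜ)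
    (u := ⟨1, by omega⟩) (v := ⟨0, by omega⟩) (by simp [T]) (by simp [T]) (by simp) ?_ (h _ ?_)
  · simp [T, forkCompl, ForkRel, PathRel]
  · have := ncard_compl_fin (T : Set (Fin (k + 3)))
    rw [Set.ncard_coe_finset, hT] at this
    omega

/-- For every `k ≥ 3` there are graphs `G` and `H` on `k+3` vertices with the same chromatic
symmetric function such that `G` is `k`-connected but not `(k+1)`-connected and `H` is
`(k-1)`-connected but not `k`-connected. -/
theorem exists_same_csf_different_connectivity (k : ℕ) (hk : 3 ≤ k) :
    ∃ G H : SimpleGraph (Fin (k + 3)), csf G = csf H ∧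
      KConnected k G ∧ ¬ KConnected (k + 1) G ∧
      KConnected (k - 1) H ∧ ¬ KConnected k H :=
  ⟨cycleCompl (k + 3), forkCompl (k + 3), csf_cycleCompl_eq_csf_forkCompl k hk,
    kConnected_cycleCompl k hk, not_kConnected_cycleCompl k hk,
    kConnected_forkCompl k hk, not_kConnected_forkCompl k hk⟩
end

section
/- For n ≥ 3, the chromatic symmetric function X_{P_n} of the path on n vertices does not lie in the ℚ-linear span of the set {X_T : T a tree on vertex set Fin n that is not isomorphic to P_n} inside MvPowerSeries ℕ ℚ. -/
open scoped Classical in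
/-- The proper colorings of `G` with colors `0, …, M` in which `u` and `v` both get color `0`. -/
noncomputable def pinnedColorings {V : Type} [Fintype V] [DecidableEq V] (G : SimpleGraph V)
    (M : ℕ) (u v : V) : Finset (V → Fin (M + 1)) :=
  {c | (∀ ⦃a b : V⦄, G.Adj a b → c a ≠ c b) ∧ c u = 0 ∧ c v = 0}

namespace SimpleGraph

variable {V : Type} {G : SimpleGraph V}

theorem IsTree.exists_existsUnique_adj_of_notMem_support [Fintype V] (hG : G.IsTree) {u v : V}
    {p : G.Walk u v} (hp : p.IsPath) {z : V} (hz : z ∉ p.support) :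
    ∃ x, x ≠ u ∧ x ≠ v ∧ ∃! y, G.Adj x y := by
  classical
  let S : Set ℕ := {k | ∃ (x : V) (q : G.Walk u x), x ∉ p.support ∧ q.IsPath ∧ q.length = k}
  have hne : S.Nonempty := by
    obtain ⟨q, hq⟩ := hG.connected.exists_isPath u z
    exact ⟨_, z, q, hz, hq, rfl⟩
  have hbdd : BddAbove S := by
    refine ⟨Fintype.card V, ?_⟩
    rintro _ ⟨x, q, -, hq, rfl⟩
    exact hq.length_lt.le
  obtain ⟨x, q, hx, hq, hlen⟩ := Nat.sSup_mem hne hbdd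
  have hxu : x ≠ u := by rintro rfl; exact hx p.start_mem_support
  have hxv : x ≠ v := by rintro rfl; exact hx p.end_mem_support
  have hnil : ¬q.Nil := Walk.not_nil_of_ne hxu.symm
  refine ⟨x, hxu, hxv, q.penultimate, (q.adj_penultimate hnil).symm, fun y hadj ↦ ?_⟩
  refine hG.isAcyclic.eq_penultimate_of_adj_end hq hadj ?_
  by_contra hy
  have hqy : (q.concat hadj).IsPath := hq.concat hy hadj
  by_cases hyp : y ∈ p.support
  · have heq := (hG.isAcyclic.subsingleton_path u y).elim ⟨_, hqy⟩ ⟨_, hp.takeUntil hyp⟩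
    have heq' : q.concat hadj = p.takeUntil y hyp := congrArg Subtype.val heq
    apply hx
    apply p.support_takeUntil_subset_support hyp
    rw [← heq']
    exact q.support_subset_support_concat _ q.end_mem_support
  · have := le_csSup hbdd (⟨y, _, hyp, hqy, rfl⟩ : (q.concat hadj).length ∈ S)
    rw [Walk.length_concat] at this
    omega

theorem IsTree.nonempty_iso_pathGraph_of_forall_mem_support {n : ℕ} {T : SimpleGraph (Fin n)}
    (hT : T.IsTree) {u v : Fin n} {p : T.Walk u v} (hp : p.IsPath) (h : ∀ w, w ∈ p.support) :
    Nonempty (T ≃g pathGraph n) := by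
  classical
  have hlen : p.length + 1 = n := by
    have := (hp.isHamiltonian_of_mem h).length_support
    simpa using this
  have hcopy : ∀ m, p.length + 1 = m → Nonempty (Copy (pathGraph m) T) := by
    rintro _ rfl
    exact ⟨hp.pathGraphCopy⟩
  obtain ⟨f⟩ := hcopy n hlen
  have hbij : Function.Bijective f := Finite.injective_iff_bijective.mp f.injective
  let e : Fin n ≃ Fin n := Equiv.ofBijective f hbij
  have hle : (pathGraph n).map e.toEmbedding ≤ T := by
    rintro _ _ ⟨-, a, b, hab, rfl, rfl⟩
    exact f.toHom.map_adj hab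
  have : Nonempty (Fin n) := ⟨u⟩
  have : (pathGraph n).Connected := ⟨pathGraph_preconnected n⟩
  have hconn : ((pathGraph n).map e.toEmbedding).Connected :=
    (Iso.map e (pathGraph n)).connected_iff.mp this
  have heq : (pathGraph n).map e.toEmbedding = T :=
    le_antisymm hle ((isTree_iff_minimal_connected.mp hT).le_of_le hconn hle)
  exact ⟨heq ▸ (Iso.map e (pathGraph n)).symm⟩

theorem IsTree.exists_existsUnique_adj_of_not_iso_pathGraph {n : ℕ} {T : SimpleGraph (Fin n)}
    (hT : T.IsTree) (h : ¬ Nonempty (T ≃g pathGraph n)) (u v : Fin n) :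
    ∃ x, x ≠ u ∧ x ≠ v ∧ ∃! y, T.Adj x y := by
  obtain ⟨p, hp⟩ := hT.connected.exists_isPath u v
  by_cases hs : ∀ w, w ∈ p.support
  · exact absurd (hT.nonempty_iso_pathGraph_of_forall_mem_support hp hs) h
  · push Not at hs
    obtain ⟨z, hz⟩ := hs
    exact hT.exists_existsUnique_adj_of_notMem_support hp hz

theorem dvd_card_pinnedColorings_of_adj [Fintype V] [DecidableEq V] {u y : V}
    (h : G.Adj u y) (M : ℕ) (v : V) :
    M ∣ Finset.card (pinnedColorings G M u v) := by
  classical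
  have hmaps : ∀ c ∈ pinnedColorings G M u v,
      c y ∈ (Finset.univ.erase 0 : Finset (Fin (M + 1))) := by
    intro c hc
    simp only [pinnedColorings, Finset.mem_filter] at hc
    have := hc.2.1 h
    rw [hc.2.2.1] at this
    simpa using this.symm
  have hfib : ∀ a ∈ (Finset.univ.erase 0 : Finset (Fin (M + 1))),
      Finset.card {c ∈ pinnedColorings G M u v | c y = a} =
        Finset.card {c ∈ pinnedColorings G M u v | c y = 1} := by
    intro a ha
    have ha : a ≠ 0 := by simpa using ha
    have h1 : (1 : Fin (M + 1)) ≠ 0 := by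
      rcases M with _ | M
      · exact absurd (Fin.fin_one_eq_zero a) ha
      · simp
    have h0 : Equiv.swap a 1 0 = 0 := Equiv.swap_apply_of_ne_of_ne ha.symm h1.symm
    refine Finset.card_nbij' (fun c ↦ Equiv.swap a 1 ∘ c) (fun c ↦ Equiv.swap a 1 ∘ c) ?_ ?_ ?_ ?_
    · intro c hc
      simp only [pinnedColorings, Finset.coe_filter, Finset.mem_filter, Set.mem_ofPred_eq] at hc ⊢
      obtain ⟨⟨-, hc, hu, hv⟩, hy⟩ := hc
      simp [hu, hv, hy, h0]
      exact hc
    · intro c hc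
      simp only [pinnedColorings, Finset.coe_filter, Finset.mem_filter, Set.mem_ofPred_eq] at hc ⊢
      obtain ⟨⟨-, hc, hu, hv⟩, hy⟩ := hc
      simp [hu, hv, hy, h0]
      exact hc
    · intro c _; ext; simp
    · intro c _; ext; simp
  rw [Finset.card_eq_sum_card_fiberwise hmaps, Finset.sum_congr rfl hfib]
  simp

theorem card_pinnedColorings_of_existsUnique_adj [Fintype V] [DecidableEq V] {x u v : V}
    (hu : u ≠ x) (hv : v ≠ x) (hx : ∃! y, G.Adj x y) (M : ℕ) :
    Finset.card (pinnedColorings G M u v) =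
      M * Finset.card (pinnedColorings (G.induce {x}ᶜ) M ⟨u, hu⟩ ⟨v, hv⟩) := by
  classical
  obtain ⟨y, hxy, hy⟩ := hx
  have hyx : y ≠ x := hxy.ne'
  let r : (V → Fin (M + 1)) → (({x}ᶜ : Set V) → Fin (M + 1)) := fun c w ↦ c w
  have hmaps : ∀ c ∈ pinnedColorings G M u v,
      r c ∈ pinnedColorings (G.induce {x}ᶜ) M ⟨u, hu⟩ ⟨v, hv⟩ := by
    intro c hc
    simp only [pinnedColorings, Finset.mem_filter, Finset.mem_univ, true_and] at hc ⊢
    exact ⟨fun a b hab ↦ hc.1 hab, hc.2⟩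
  rw [Finset.card_eq_sum_card_fiberwise hmaps, mul_comm]
  refine Finset.sum_const_nat fun c' hc' ↦ ?_
  simp only [pinnedColorings, Finset.mem_filter, Finset.mem_univ, true_and] at hc'
  have hcard : Finset.card (Finset.univ.erase (c' ⟨y, hyx⟩)) = M := by simp
  refine Eq.trans (Finset.card_nbij' (fun c ↦ c x)
    (fun a w ↦ if hw : w = x then a else c' ⟨w, hw⟩) ?_ ?_ ?_ ?_) hcard
  · intro c hc
    simp only [pinnedColorings, Finset.coe_filter, Finset.mem_filter, Set.mem_ofPred_eq] at hc
    obtain ⟨⟨-, hc, -, -⟩, rfl⟩ := hc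
    simpa [r] using hc hxy
  · intro a ha
    have ha : a ≠ c' ⟨y, hyx⟩ := by simpa using ha
    simp only [pinnedColorings, Finset.coe_filter, Finset.mem_filter, Set.mem_ofPred_eq]
    refine ⟨⟨Finset.mem_univ _, ?_, ?_, ?_⟩, ?_⟩
    · intro b d hbd
      by_cases hb : b = x
      · subst hb
        obtain rfl := hy d hbd
        simpa [hyx] using ha
      · by_cases hd : d = x
        · subst hd
          obtain rfl := hy b hbd.symm
          simpa [hyx] using ha.symm
        · have hbd' : (G.induce {x}ᶜ).Adj ⟨b, hb⟩ ⟨d, hd⟩ := hbd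
          simpa [hb, hd] using hc'.1 hbd'
    · simpa [hu] using hc'.2.1
    · simpa [hv] using hc'.2.2
    · ext ⟨w, hw⟩
      have hw : w ≠ x := hw
      simp [r, hw]
  · intro c hc
    simp only [Finset.coe_filter, Set.mem_ofPred_eq] at hc
    obtain ⟨-, rfl⟩ := hc
    funext w
    by_cases hw : w = x
    · simp [hw]
    · simp [hw, r]
  · intro a _
    simp

theorem Connected.sq_dvd_card_pinnedColorings [Fintype V] [DecidableEq V] (hG : G.Connected)
    (hV : 3 ≤ Fintype.card V) {x u v : V} (hu : x ≠ u) (hv : x ≠ v) (hx : ∃! y, G.Adj x y)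
    (M : ℕ) : M ^ 2 ∣ Finset.card (pinnedColorings G M u v) := by
  classical
  rw [card_pinnedColorings_of_existsUnique_adj hu.symm hv.symm hx, sq]
  have hconn : (G.induce {x}ᶜ).Connected :=
    hG.induce_compl_singleton_of_degree_eq_one (degree_eq_one_iff_existsUnique_adj.mpr hx)
  have : Nontrivial ({x}ᶜ : Set V) := by
    rw [← Fintype.one_lt_card_iff_nontrivial, Fintype.card_compl_set]
    simp
    omega
  obtain ⟨y, hy⟩ := hconn.preconnected.exists_adj_of_nontrivial (⟨u, hu.symm⟩ : ({x}ᶜ : Set V))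
  exact mul_dvd_mul_left M (dvd_card_pinnedColorings_of_adj hy M _)

end SimpleGraph

/-- The colorings of `P_{m+1}` with colors `0, …, M` that are proper and start with color `0`. -/
def pathColorings (M m : ℕ) : Finset (Fin (m + 1) → Fin (M + 1)) :=
  {c | (∀ i : Fin m, c i.castSucc ≠ c i.succ) ∧ c 0 = 0}

theorem mem_pathColorings {M m : ℕ} {c : Fin (m + 1) → Fin (M + 1)} :
    c ∈ pathColorings M m ↔ (∀ i : Fin m, c i.castSucc ≠ c i.succ) ∧ c 0 = 0 := by
  simp [pathColorings]

theorem snoc_mem_pathColorings {M m : ℕ} {c : Fin (m + 1) → Fin (M + 1)} {a : Fin (M + 1)} :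
    (Fin.snoc c a : Fin (m + 2) → Fin (M + 1)) ∈ pathColorings M (m + 1) ↔
      c ∈ pathColorings M m ∧ a ≠ c (Fin.last m) := by
  have h0 : (Fin.snoc c a : Fin (m + 2) → Fin (M + 1)) 0 = c 0 := by
    rw [← Fin.castSucc_zero, Fin.snoc_castSucc (α := fun _ ↦ Fin (M + 1))]
  have hs (i : Fin m) : (Fin.snoc c a : Fin (m + 2) → Fin (M + 1)) i.castSucc.succ = c i.succ := by
    rw [Fin.succ_castSucc, Fin.snoc_castSucc (α := fun _ ↦ Fin (M + 1))]
  simp only [mem_pathColorings, Fin.forall_fin_succ', h0, hs, Fin.snoc_castSucc, Fin.succ_last,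
    Fin.snoc_last]
  tauto

theorem card_pathColorings (M m : ℕ) : (pathColorings M m).card = M ^ m := by
  induction m with
  | zero =>
    rw [pow_zero, Finset.card_eq_one]
    refine ⟨0, ?_⟩
    ext c
    simp [mem_pathColorings, funext_iff, Fin.forall_fin_one]
  | succ m ih =>
    have hmaps : ∀ c ∈ pathColorings M (m + 1), Fin.init c ∈ pathColorings M m := by
      intro c hc
      rw [← Fin.snoc_init_self c] at hc
      exact (snoc_mem_pathColorings.mp hc).1
    rw [Finset.card_eq_sum_card_fiberwise hmaps, pow_succ, ← ih]
    refine Finset.sum_const_nat fun c' hc' ↦ ?_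
    have hcard : (Finset.univ.erase (c' (Fin.last m))).card = M := by simp
    refine Eq.trans (Finset.card_nbij' (fun c ↦ c (Fin.last _)) (fun a ↦ Fin.snoc c' a)
      ?_ ?_ ?_ ?_) hcard
    · intro c hc
      obtain ⟨hmem, rfl⟩ := Finset.mem_filter.mp hc
      rw [← Fin.snoc_init_self c] at hmem
      simpa using (snoc_mem_pathColorings.mp hmem).2
    · intro a ha
      simpa [snoc_mem_pathColorings, hc', Fin.init_snoc] using ha
    · intro c hc
      obtain ⟨hc, rfl⟩ := Finset.mem_filter.mp hc
      exact Fin.snoc_init_self c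
    · intro a _
      exact Fin.snoc_last (α := fun _ ↦ Fin (M + 1)) _ _

theorem card_filter_pathColorings_last_succ (M m : ℕ) :
    ((pathColorings M (m + 1)).filter fun c ↦ c (Fin.last _) = 0).card =
      ((pathColorings M m).filter fun c ↦ ¬ c (Fin.last _) = 0).card := by
  refine Finset.card_nbij' (fun c ↦ Fin.init c) (fun c ↦ Fin.snoc c 0) ?_ ?_ ?_ ?_
  · intro c hc
    obtain ⟨hc, h0⟩ := Finset.mem_filter.mp hc
    rw [← Fin.snoc_init_self c, h0, snoc_mem_pathColorings] at hc
    exact Finset.mem_filter.mpr ⟨hc.1, hc.2.symm⟩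
  · intro c hc
    obtain ⟨hc, h0⟩ := Finset.mem_filter.mp hc
    exact Finset.mem_filter.mpr ⟨snoc_mem_pathColorings.mpr ⟨hc, Ne.symm h0⟩,
      Fin.snoc_last (α := fun _ ↦ Fin (M + 1)) _ _⟩
  · intro c hc
    obtain ⟨hc, h0⟩ := Finset.mem_filter.mp hc
    simp only
    rw [← h0]
    exact Fin.snoc_init_self c
  · intro c _
    exact Fin.init_snoc (α := fun _ ↦ Fin (M + 1)) _ _

theorem card_filter_pathColorings_last_add (M m : ℕ) :
    (((pathColorings M (m + 1)).filter fun c ↦ c (Fin.last _) = 0).card : ℤ) =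
      M ^ m - ((pathColorings M m).filter fun c ↦ c (Fin.last _) = 0).card := by
  rw [card_filter_pathColorings_last_succ, eq_sub_iff_add_eq', ← Nat.cast_add,
    Finset.card_filter_add_card_filter_not, card_pathColorings, Nat.cast_pow]

theorem sq_dvd_card_filter_pathColorings_last_sub (M m : ℕ) :
    (M : ℤ) ^ 2 ∣ ((pathColorings M (m + 2)).filter fun c ↦ c (Fin.last _) = 0).card
      - (-1) ^ m * M := by
  induction m with
  | zero =>
    have h0 : (pathColorings M 0).filter (fun c ↦ c (Fin.last _) = 0) = pathColorings M 0 := by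
      refine Finset.filter_true_of_mem fun c hc ↦ (mem_pathColorings.mp hc).2
    rw [card_filter_pathColorings_last_add, card_filter_pathColorings_last_add, h0,
      card_pathColorings]
    simp
  | succ m ih =>
    rw [card_filter_pathColorings_last_add]
    have : (M : ℤ) ^ 2 ∣ M ^ (m + 2) := pow_dvd_pow _ (by omega)
    refine (dvd_sub this ih).trans (dvd_of_eq ?_)
    ring

theorem pinnedColorings_pathGraph (M m : ℕ) :
    pinnedColorings (SimpleGraph.pathGraph (m + 1)) M 0 (Fin.last m) =
      (pathColorings M m).filter fun c ↦ c (Fin.last _) = 0 := by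
  ext c
  simp only [pinnedColorings, Finset.mem_filter, Finset.mem_univ, true_and, mem_pathColorings,
    and_assoc]
  refine and_congr_left' ⟨fun h i ↦ h ?_, fun h a b hab ↦ ?_⟩
  · simp [SimpleGraph.pathGraph_adj]
  · rw [SimpleGraph.pathGraph_adj] at hab
    rcases hab with hab | hab
    · have hb : b = Fin.succ ⟨a, by omega⟩ := Fin.ext hab.symm
      rw [hb]
      exact h ⟨a, by omega⟩
    · have ha : a = Fin.succ ⟨b, by omega⟩ := Fin.ext hab.symm
      rw [ha]
      exact (h ⟨b, by omega⟩).symm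

theorem pinnedColorings_comm {V : Type} [Fintype V] [DecidableEq V] (G : SimpleGraph V) (M : ℕ)
    (u v : V) : pinnedColorings G M u v = pinnedColorings G M v u := by
  ext c
  simp [pinnedColorings, and_comm (a := c u = 0)]

theorem sq_dvd_sum_card_pinnedColorings_pathGraph_sub (M m : ℕ) :
    (M : ℤ) ^ 2 ∣ (∑ u, ∑ v, (pinnedColorings (SimpleGraph.pathGraph (m + 3)) M u v).card : ℕ)
      - 2 * (-1) ^ m * M := by
  have h0l : (0 : Fin (m + 3)) ≠ Fin.last (m + 2) := by simp [Fin.ext_iff]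
  have hfst : ∃! y, (SimpleGraph.pathGraph (m + 3)).Adj 0 y := by
    refine ⟨1, by simp [SimpleGraph.pathGraph_adj], fun y hy ↦ ?_⟩
    simp only [SimpleGraph.pathGraph_adj, Fin.ext_iff, Fin.val_zero, Fin.val_one] at hy ⊢
    omega
  have hlst : ∃! y, (SimpleGraph.pathGraph (m + 3)).Adj (Fin.last _) y := by
    refine ⟨(Fin.last (m + 1)).castSucc, by simp [SimpleGraph.pathGraph_adj], fun y hy ↦ ?_⟩
    simp only [SimpleGraph.pathGraph_adj, Fin.ext_iff, Fin.val_last, Fin.val_castSucc] at hy ⊢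
    omega
  have hdvd : ∀ u v : Fin (m + 3), ¬ (u = 0 ∧ v = Fin.last _) → ¬ (u = Fin.last _ ∧ v = 0) →
      (M : ℤ) ^ 2 ∣ (pinnedColorings (SimpleGraph.pathGraph (m + 3)) M u v).card := by
    intro u v h1 h2
    have hconn := SimpleGraph.pathGraph_connected (m + 2)
    have hcard : 3 ≤ Fintype.card (Fin (m + 3)) := by simp
    by_cases hx : 0 ≠ u ∧ 0 ≠ v
    · exact_mod_cast hconn.sq_dvd_card_pinnedColorings hcard hx.1 hx.2 hfst M
    · have hx' : Fin.last (m + 2) ≠ u ∧ Fin.last (m + 2) ≠ v := by grind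
      exact_mod_cast hconn.sq_dvd_card_pinnedColorings hcard hx'.1 hx'.2 hlst M
  have hW := sq_dvd_card_filter_pathColorings_last_sub M m
  rw [← pinnedColorings_pathGraph] at hW
  set W := pinnedColorings (SimpleGraph.pathGraph (m + 2 + 1)) M 0 (Fin.last (m + 2)) with hWdef
  have hsum : (2 * (W.card : ℤ)) = ∑ u : Fin (m + 3), ∑ v : Fin (m + 3),
      if (u = 0 ∧ v = Fin.last _) ∨ (u = Fin.last _ ∧ v = 0) then (W.card : ℤ) else 0 := by
    rw [← Fintype.sum_prod_type', ← Finset.sum_filter, Finset.sum_const]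
    have : Finset.univ.filter (fun x : Fin (m + 3) × Fin (m + 3) ↦
        (x.1 = 0 ∧ x.2 = Fin.last _) ∨ (x.1 = Fin.last _ ∧ x.2 = 0)) =
        {(0, Fin.last _), (Fin.last _, 0)} := by
      ext ⟨a, b⟩; simp
    rw [this, Finset.card_pair (by simp [h0l])]
    simp
  have hkey : (M : ℤ) ^ 2 ∣
      (∑ u, ∑ v, (pinnedColorings (SimpleGraph.pathGraph (m + 3)) M u v).card : ℕ)
        - 2 * (W.card : ℤ) := by
    rw [hsum]
    push_cast
    simp_rw [← Finset.sum_sub_distrib]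
    refine Finset.dvd_sum fun u _ ↦ Finset.dvd_sum fun v _ ↦ ?_
    split_ifs with h
    · rcases h with ⟨rfl, rfl⟩ | ⟨rfl, rfl⟩
      · simp [hWdef]
      · rw [pinnedColorings_comm]
        simp [hWdef]
    · rw [sub_zero]
      exact hdvd u v (fun h' ↦ h (Or.inl h')) (fun h' ↦ h (Or.inr h'))
  refine (dvd_add hkey (hW.mul_left 2)).trans (dvd_of_eq ?_)
  ring

/-- The color class size vector of a coloring `c`. -/
noncomputable def classSizes {V : Type} [Fintype V] {M : ℕ} (c : V → Fin (M + 1)) : ℕ →₀ ℕ :=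
  ∑ x, Finsupp.single (c x : ℕ) 1

theorem classSizes_apply {V : Type} [Fintype V] {M : ℕ} (c : V → Fin (M + 1)) (i : ℕ) :
    classSizes c i = (Finset.univ.filter fun x ↦ (c x : ℕ) = i).card := by
  simp [classSizes, Finsupp.finsetSum_apply, Finsupp.single_apply]

theorem classSizes_mem_finsuppAntidiag {V : Type} [Fintype V] {M : ℕ} (c : V → Fin (M + 1)) :
    classSizes c ∈ (Finset.range (M + 1)).finsuppAntidiag (Fintype.card V) := by
  rw [Finset.mem_finsuppAntidiag]
  constructor
  · simp_rw [classSizes_apply]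
    exact (Finset.card_eq_sum_card_fiberwise (fun x _ ↦ by simp [Fin.is_le])).symm
  · intro i hi
    rw [Finsupp.mem_support_iff, classSizes_apply, Finset.card_ne_zero] at hi
    obtain ⟨x, hx⟩ := hi
    obtain rfl := (Finset.mem_filter.mp hx).2
    exact Finset.mem_range.mpr (c x).isLt

open scoped Classical in
theorem numColorings_eq_card {V : Type} [Fintype V] [DecidableEq V] (G : SimpleGraph V) {M : ℕ}
    {d : ℕ →₀ ℕ} (hd : d.support ⊆ Finset.range (M + 1)) :
    numColorings G d = (Finset.univ.filter fun c : V → Fin (M + 1) ↦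
      (∀ ⦃a b : V⦄, G.Adj a b → c a ≠ c b) ∧ classSizes c = d).card := by
  have hsizes (c : V → ℕ) (i : ℕ) :
      Nat.card {x : V // c x = i} = (Finset.univ.filter fun x ↦ c x = i).card := by
    rw [Nat.card_eq_fintype_card, Fintype.card_subtype]
  rw [numColorings, ← Fintype.card_subtype, ← Nat.card_eq_fintype_card]
  let f : {c : V → Fin (M + 1) // (∀ ⦃a b : V⦄, G.Adj a b → c a ≠ c b) ∧ classSizes c = d} →
      {c : V → ℕ // (∀ ⦃u v : V⦄, G.Adj u v → c u ≠ c v) ∧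
        ∀ i : ℕ, Nat.card {x : V // c x = i} = d i} := fun c ↦
    ⟨fun x ↦ (c.1 x : ℕ), fun a b hab h ↦ c.2.1 hab (Fin.ext h), fun i ↦ by
      rw [hsizes, ← classSizes_apply, c.2.2]⟩
  refine (Nat.card_eq_of_bijective f ⟨?_, ?_⟩).symm
  · rintro ⟨c, hc⟩ ⟨c', hc'⟩ h
    ext x
    exact congrFun (congrArg Subtype.val h) x
  · rintro ⟨c, hc, hcd⟩
    have hlt : ∀ x, c x < M + 1 := by
      intro x
      refine Finset.mem_range.mp (hd (Finsupp.mem_support_iff.mpr ?_))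
      rw [← hcd, hsizes]
      exact Finset.card_ne_zero_of_mem (Finset.mem_filter.mpr ⟨Finset.mem_univ x, rfl⟩)
    refine ⟨⟨fun x ↦ ⟨c x, hlt x⟩, fun a b hab h ↦ hc hab (Fin.ext_iff.mp h), ?_⟩, rfl⟩
    ext i
    rw [classSizes_apply, ← hcd, hsizes]

/-- The linear functional sending `X_G`, for a graph `G` on `n` vertices, to the sum of
`|c⁻¹(0)|²` over all proper colorings `c` of `G` with colors `0, …, M`. -/
noncomputable def sqZeroClassSum (n M : ℕ) : MvPowerSeries ℕ ℚ →ₗ[ℚ] ℚ :=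
  ∑ d ∈ (Finset.range (M + 1)).finsuppAntidiag n, (d 0 : ℚ) ^ 2 • MvPowerSeries.coeff d

theorem sqZeroClassSum_csf {V : Type} [Fintype V] [DecidableEq V] (G : SimpleGraph V) (M : ℕ) :
    sqZeroClassSum (Fintype.card V) M (csf G) =
      ((∑ u, ∑ v, (pinnedColorings G M u v).card : ℕ) : ℚ) := by
  classical
  let P : Finset (V → Fin (M + 1)) := {c | ∀ ⦃a b : V⦄, G.Adj a b → c a ≠ c b}
  have hpin (u v : V) :
      (pinnedColorings G M u v).card = ∑ c ∈ P, if c u = 0 ∧ c v = 0 then 1 else 0 := by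
    rw [← Finset.card_filter, Finset.filter_filter]
    rfl
  have hsq (c : V → Fin (M + 1)) :
      (∑ u, ∑ v, if c u = 0 ∧ c v = 0 then 1 else 0) = classSizes c 0 ^ 2 := by
    simp only [classSizes_apply, sq, Finset.card_filter, Finset.sum_mul_sum, ite_and, Fin.ext_iff,
      Fin.val_zero, ite_mul, one_mul, zero_mul]
  have hsum : ∑ u, ∑ v, (pinnedColorings G M u v).card = ∑ c ∈ P, classSizes c 0 ^ 2 := by
    simp_rw [hpin, ← hsq]
    rw [Finset.sum_comm (s := P)]
    refine Finset.sum_congr rfl fun u _ ↦ ?_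
    rw [Finset.sum_comm]
  rw [hsum, ← Finset.sum_fiberwise_of_maps_to (fun c _ ↦ classSizes_mem_finsuppAntidiag c)]
  simp only [sqZeroClassSum, LinearMap.sum_apply, LinearMap.smul_apply, smul_eq_mul]
  rw [Nat.cast_sum]
  refine Finset.sum_congr rfl fun d hd ↦ ?_
  have hcoeff : MvPowerSeries.coeff d (csf G) = (numColorings G d : ℚ) := rfl
  have hfib : ∑ c ∈ P with classSizes c = d, classSizes c 0 ^ 2 =
      (P.filter fun c ↦ classSizes c = d).card * d 0 ^ 2 :=
    Finset.sum_const_nat fun c hc ↦ by rw [(Finset.mem_filter.mp hc).2]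
  rw [hcoeff, numColorings_eq_card G (Finset.mem_finsuppAntidiag.mp hd).2, hfib,
    Finset.filter_filter]
  push_cast
  ring

/-- For `n ≥ 3`, the chromatic symmetric function of the path `P_n` does not lie in the
ℚ-linear span of the chromatic symmetric functions of `n`-vertex trees not isomorphic
to `P_n`. -/
theorem path_not_in_span (n : ℕ) (hn : 3 ≤ n) :
    csf (SimpleGraph.pathGraph n) ∉ Submodule.span ℚ
      {x : MvPowerSeries ℕ ℚ | ∃ T : SimpleGraph (Fin n), T.IsTree ∧
        ¬ Nonempty (T ≃g SimpleGraph.pathGraph n) ∧ x = csf T} := by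
  intro hmem
  have hdiv : ∃ D : ℤ, D ≠ 0 ∧ ∀ M : ℕ, ∃ k : ℤ,
      D * sqZeroClassSum n M (csf (SimpleGraph.pathGraph n)) = k * (M : ℚ) ^ 2 := by
    generalize csf (SimpleGraph.pathGraph n) = f at hmem ⊢
    induction hmem using Submodule.span_induction with
    | mem x hx =>
      obtain ⟨T, hT, hiso, rfl⟩ := hx
      refine ⟨1, one_ne_zero, fun M ↦ ?_⟩
      have hsq : M ^ 2 ∣ ∑ u, ∑ v, (pinnedColorings T M u v).card := by
        refine Finset.dvd_sum fun u _ ↦ Finset.dvd_sum fun v _ ↦ ?_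
        obtain ⟨x, hxu, hxv, hx⟩ := hT.exists_existsUnique_adj_of_not_iso_pathGraph hiso u v
        exact hT.connected.sq_dvd_card_pinnedColorings (by simpa using hn) hxu hxv hx M
      obtain ⟨k, hk⟩ := hsq
      have hcsf := sqZeroClassSum_csf T M
      rw [Fintype.card_fin, hk] at hcsf
      refine ⟨k, ?_⟩
      rw [hcsf]
      push_cast
      ring
    | zero => exact ⟨1, one_ne_zero, fun M ↦ ⟨0, by simp⟩⟩
    | add x y _ _ hx hy =>
      obtain ⟨D, hD, hx⟩ := hx
      obtain ⟨E, hE, hy⟩ := hy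
      refine ⟨D * E, mul_ne_zero hD hE, fun M ↦ ?_⟩
      obtain ⟨k, hk⟩ := hx M
      obtain ⟨l, hl⟩ := hy M
      refine ⟨E * k + D * l, ?_⟩
      rw [map_add]
      push_cast
      linear_combination (E : ℚ) * hk + (D : ℚ) * hl
    | smul a x _ hx =>
      obtain ⟨D, hD, hx⟩ := hx
      refine ⟨a.den * D, mul_ne_zero (by exact_mod_cast a.den_ne_zero) hD, fun M ↦ ?_⟩
      obtain ⟨k, hk⟩ := hx M
      refine ⟨a.num * k, ?_⟩
      have ha : (a.den : ℚ) * a = a.num := Rat.den_mul_eq_num a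
      rw [map_smul, smul_eq_mul]
      push_cast
      linear_combination (a.num : ℚ) * hk +
        (D : ℚ) * sqZeroClassSum n M x * ha
  obtain ⟨D, hD, hdiv⟩ := hdiv
  obtain ⟨m, rfl⟩ := Nat.exists_eq_add_of_le' hn
  set M := 2 * D.natAbs + 1 with hM
  obtain ⟨k, hk⟩ := hdiv M
  have hcsf := sqZeroClassSum_csf (SimpleGraph.pathGraph (m + 3)) M
  rw [Fintype.card_fin] at hcsf
  rw [hcsf] at hk
  obtain ⟨j, hj⟩ := sq_dvd_sum_card_pinnedColorings_pathGraph_sub M m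
  have hk' : D * (∑ u, ∑ v, (pinnedColorings (SimpleGraph.pathGraph (m + 3)) M u v).card : ℕ) =
      k * (M : ℤ) ^ 2 := by exact_mod_cast hk
  have hM0 : (M : ℤ) ≠ 0 := by omega
  have hmul : 2 * D * (-1) ^ m = M * (k - D * j) := by
    refine mul_right_cancel₀ hM0 ?_
    linear_combination hk' - D * hj
  have hdvd : (M : ℤ) ∣ 2 * D := by
    have hsign : ((-1 : ℤ) ^ m) * (-1) ^ m = 1 := by rw [← mul_pow]; simp
    refine ⟨(k - D * j) * (-1) ^ m, ?_⟩
    linear_combination (-1 : ℤ) ^ m * hmul - 2 * D * hsign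
  have hle := Int.le_of_dvd (by positivity) ((dvd_abs _ _).mpr hdvd)
  rw [abs_mul, abs_two, Int.abs_eq_natAbs] at hle
  omega
end
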